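/- Let f_{Z_n} denote the density of Z_n = √(12/n)(X_n − n/2), where X_n is the sum of n i.i.d. Uniform(0,1) random variables, and let φ denote the standard normal density. Then there is a constant C such that for all n ≥ 1, sup_x |f_{Z_n}(x) − φ(x)| ≤ C/n. -/

import Mathlib

open Real MeasureTheory

/-- The density of the standardized Irwin-Hall variable `Z_n = √(12/n)(X_n - n/2)`,
expressed by Fourier inversion of its characteristic function. -/
noncomputable def irwinHallStdDensity (n : ℕ) (x : ℝ) : ℝ :=
  (1 / (2 * π)) *
    ∫ t : ℝ, Real.cos (t * x) *
      (if t = 0 then 1 else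
        Real.sin (Real.sqrt 3 * t / Real.sqrt n) / (Real.sqrt 3 * t / Real.sqrt n)) ^ n

theorem Real.cos_le_one_sub_add_quartic {x : ℝ} (hx : 0 ≤ x) :
    cos x ≤ 1 - x ^ 2 / 2 + x ^ 4 / 24 := by
  let f (t : ℝ) : ℝ := 1 - t ^ 2 / 2 + t ^ 4 / 24 - cos t
  have hderiv (t : ℝ) : deriv f t = sin t - (t - t ^ 3 / 6) := by
    simp (disch := fun_prop) [f]
    ring
  have hmono : MonotoneOn f (Set.Ici 0) := by
    apply monotoneOn_of_deriv_nonneg (convex_Ici 0) (by fun_prop) (by fun_prop)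
    intro t ht
    rw [interior_Ici] at ht
    rw [hderiv]
    linarith [sin_ge_sub_cube (le_of_lt ht)]
  have h0 : f 0 ≤ f x := hmono (by simp) hx hx
  simp only [f, cos_zero] at h0
  linarith

theorem Real.sin_le_sub_cube_add_quintic {x : ℝ} (hx : 0 ≤ x) :
    sin x ≤ x - x ^ 3 / 6 + x ^ 5 / 120 := by
  let f (t : ℝ) : ℝ := t - t ^ 3 / 6 + t ^ 5 / 120 - sin t
  have hderiv (t : ℝ) : deriv f t = 1 - t ^ 2 / 2 + t ^ 4 / 24 - cos t := by
    simp (disch := fun_prop) [f]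
    ring
  have hmono : MonotoneOn f (Set.Ici 0) := by
    apply monotoneOn_of_deriv_nonneg (convex_Ici 0) (by fun_prop) (by fun_prop)
    intro t ht
    rw [interior_Ici] at ht
    rw [hderiv]
    linarith [cos_le_one_sub_add_quartic (le_of_lt ht)]
  have h0 : f 0 ≤ f x := hmono (by simp) hx hx
  simp only [f, sin_zero] at h0
  linarith

theorem Real.one_sub_sq_div_six_le_sinc (s : ℝ) : 1 - s ^ 2 / 6 ≤ sinc s := by
  wlog hs : 0 ≤ s
  · simpa using this (-s) (by linarith)
  rcases hs.eq_or_lt with rfl | hs'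
  · simp
  rw [sinc_of_ne_zero hs'.ne', le_div_iff₀ hs']
  linarith [sin_ge_sub_cube hs]

theorem Real.sinc_le_one_sub_add_quartic (s : ℝ) :
    sinc s ≤ 1 - s ^ 2 / 6 + s ^ 4 / 120 := by
  wlog hs : 0 ≤ s
  · simpa [Even.neg_pow (by decide : Even 4)] using this (-s) (by linarith)
  rcases hs.eq_or_lt with rfl | hs'
  · simp
  rw [sinc_of_ne_zero hs'.ne', div_le_iff₀ hs']
  linarith [sin_le_sub_cube_add_quintic hs]

theorem Real.exp_neg_le_inv_one_add {y : ℝ} (hy : 0 ≤ y) : exp (-y) ≤ (1 + y)⁻¹ := by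
  rw [exp_neg]
  gcongr
  linarith [add_one_le_exp y]

theorem Real.abs_sinc_sub_exp_le (s : ℝ) : |sinc s - exp (-(s ^ 2 / 6))| ≤ s ^ 4 := by
  have hy : 0 ≤ s ^ 2 / 6 := by positivity
  have h1 := one_sub_sq_div_six_le_sinc s
  have h2 := sinc_le_one_sub_add_quartic s
  have h3 := add_one_le_exp (-(s ^ 2 / 6))
  have h4 : exp (-(s ^ 2 / 6)) ≤ 1 - s ^ 2 / 6 + (s ^ 2 / 6) ^ 2 := by
    refine (exp_neg_le_inv_one_add hy).trans ?_
    rw [inv_le_iff_one_le_mul₀ (by positivity)]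
    nlinarith [pow_nonneg hy 3]
  have h5 : 0 ≤ s ^ 4 := by positivity
  rw [abs_le]
  constructor <;> nlinarith

theorem Real.sinc_sq_le_inv (s : ℝ) : sinc s ^ 2 ≤ (1 + s ^ 2 / 3)⁻¹ := by
  wlog hs : 0 ≤ s
  · simpa using this (-s) (by linarith)
  rw [← one_div, le_div_iff₀ (by positivity)]
  rcases le_or_gt (3 / 2) (s ^ 2) with h | h
  · have hs0 : s ≠ 0 := by
      rintro rfl
      norm_num at h
    have hsin : sinc s ^ 2 * s ^ 2 ≤ 1 := by
      rw [sinc_of_ne_zero hs0, ← mul_pow, div_mul_cancel₀ _ hs0]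
      exact sin_sq_le_one s
    have hle : sinc s ^ 2 ≤ 2 / 3 := by nlinarith [sq_nonneg (sinc s)]
    linarith
  · have h0 : 0 ≤ sinc s := by linarith [one_sub_sq_div_six_le_sinc s]
    have hq : sinc s ≤ 1 - s ^ 2 / 6 + (s ^ 2) ^ 2 / 120 := by
      linarith [sinc_le_one_sub_add_quartic s]
    generalize hqs : s ^ 2 = q at *
    have hq0 : 0 ≤ q := hqs ▸ sq_nonneg s
    calc sinc s ^ 2 * (1 + q / 3) ≤ (1 - q / 6 + q ^ 2 / 120) ^ 2 * (1 + q / 3) := by gcongr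
      _ = 1 - q ^ 2 * (1 / 15 - 13 * q / 1080 + q ^ 2 * (37 - q) / 43200) := by ring
      _ ≤ 1 := by
        have : 0 ≤ q ^ 2 * (37 - q) := mul_nonneg (sq_nonneg q) (by linarith)
        have : 0 ≤ q ^ 2 * (1 / 15 - 13 * q / 1080 + q ^ 2 * (37 - q) / 43200) :=
          mul_nonneg (sq_nonneg q) (by linarith)
        linarith

theorem Real.max_abs_sinc_exp_sq_le (s : ℝ) :
    max |sinc s| |exp (-(s ^ 2 / 6))| ^ 2 ≤ (1 + s ^ 2 / 3)⁻¹ := by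
  rcases max_choice |sinc s| |exp (-(s ^ 2 / 6))| with h | h <;> rw [h, sq_abs]
  · exact sinc_sq_le_inv s
  · rw [← exp_nat_mul]
    refine le_trans (le_of_eq ?_) (exp_neg_le_inv_one_add (y := s ^ 2 / 3) (by positivity))
    congr 1
    push_cast
    ring

theorem sqrt_three_mul_div_sqrt_sq (n : ℕ) (t : ℝ) :
    (√3 * t / √n) ^ 2 = 3 * (t ^ 2 / n) := by
  rw [div_pow, mul_pow, sq_sqrt (by norm_num), sq_sqrt (by positivity)]
  ring

theorem irwinHallStdDensity_eq_sinc (n : ℕ) (hn : 1 ≤ n) (x : ℝ) :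
    irwinHallStdDensity n x =
      (1 / (2 * π)) * ∫ t : ℝ, cos (t * x) * sinc (√3 * t / √n) ^ n := by
  have hn' : 0 < √(n : ℝ) := by positivity
  have hzero (t : ℝ) : √3 * t / √n = 0 ↔ t = 0 := by simp [hn'.ne']
  simp only [irwinHallStdDensity, sinc_apply, hzero]

theorem integral_cos_mul_exp_neg_sq_div_two (x : ℝ) :
    (1 / (2 * π)) * ∫ t : ℝ, cos (t * x) * exp (-(t ^ 2 / 2)) =
      (1 / √(2 * π)) * exp (-x ^ 2 / 2) := by
  have h := fourierIntegral_gaussian (b := 1 / 2) (by norm_num) x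
  have hc : ((π : ℂ) / (1 / 2)) ^ (1 / 2 : ℂ) = ((√(2 * π) : ℝ) : ℂ) := by
    rw [sqrt_eq_rpow, Complex.ofReal_cpow (by positivity)]
    push_cast
    congr 1
    ring
  have hint : Integrable fun t : ℝ ↦
      Complex.exp (Complex.I * x * t) * Complex.exp (-(1 / 2) * t ^ 2) := by
    have := integrable_cexp_quadratic (b := 1 / 2) (by norm_num) (Complex.I * x) 0
    refine this.congr (.of_forall fun t ↦ ?_)
    simp only [← Complex.exp_add]
    congr 1
    ring
  have h2 := congrArg Complex.re h
  rw [hc, ← RCLike.re_eq_complex_re, ← integral_re hint] at h2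
  have h3 : ∀ t : ℝ, RCLike.re (Complex.exp (Complex.I * x * t) *
      Complex.exp (-(1 / 2) * t ^ 2)) = cos (t * x) * exp (-(t ^ 2 / 2)) := by
    intro t
    have e1 : Complex.I * x * t = ((t * x : ℝ) : ℂ) * Complex.I := by push_cast; ring
    have e2 : (-(1 / 2) * t ^ 2 : ℂ) = ((-(t ^ 2 / 2) : ℝ) : ℂ) := by push_cast; ring
    rw [e1, e2, ← Complex.ofReal_exp, RCLike.re_eq_complex_re, Complex.re_mul_ofReal,
      Complex.exp_ofReal_mul_I_re]
  have h4 : (-(x : ℂ) ^ 2 / (4 * (1 / 2))) = ((-x ^ 2 / 2 : ℝ) : ℂ) := by push_cast; ring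
  simp only [h3] at h2
  rw [h2, h4, ← Complex.ofReal_exp, ← Complex.ofReal_mul, RCLike.re_eq_complex_re,
    Complex.ofReal_re]
  have : √(2 * π) ^ 2 = 2 * π := sq_sqrt (by positivity)
  have : 0 < √(2 * π) := by positivity
  field_simp
  linarith

theorem abs_sinc_pow_le (n : ℕ) (hn : 2 ≤ n) (t : ℝ) :
    |sinc (√3 * t / √n) ^ n| ≤ n * (1 + t ^ 2)⁻¹ := by
  have hn' : (1 : ℝ) ≤ n := by exact_mod_cast (by omega : 1 ≤ n)
  calc |sinc (√3 * t / √n) ^ n| ≤ |sinc (√3 * t / √n)| ^ 2 := by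
        rw [abs_pow]
        exact pow_le_pow_of_le_one (abs_nonneg _) (abs_sinc_le_one _) hn
    _ ≤ (1 + t ^ 2 / n)⁻¹ := by
        rw [sq_abs]
        refine (sinc_sq_le_inv _).trans (le_of_eq ?_)
        rw [sqrt_three_mul_div_sqrt_sq]
        ring
    _ ≤ n * (1 + t ^ 2)⁻¹ := by
        have : 0 < 1 + t ^ 2 := by positivity
        have h : 1 + t ^ 2 / n = (n + t ^ 2) / n := by field_simp
        rw [h, inv_div, div_eq_mul_inv]
        gcongr

theorem abs_sinc_pow_sub_exp_le (n : ℕ) (hn : 7 ≤ n) (t : ℝ) :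
    |sinc (√3 * t / √n) ^ n - exp (-(t ^ 2 / 2))| ≤ 15552 / n * (1 + t ^ 2)⁻¹ := by
  have hn' : (0 : ℝ) < n := by exact_mod_cast (by omega : 0 < n)
  set s := √3 * t / √n
  have hs2 : s ^ 2 = 3 * (t ^ 2 / n) := sqrt_three_mul_div_sqrt_sq n t
  have hexp : exp (-(t ^ 2 / 2)) = exp (-(s ^ 2 / 6)) ^ n := by
    rw [← exp_nat_mul, hs2]
    congr 1
    field_simp
    ring
  set M := max |sinc s| |exp (-(s ^ 2 / 6))|
  have hM0 : 0 ≤ M := le_max_of_le_left (abs_nonneg _)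
  have hM1 : M ≤ 1 := by
    refine max_le (abs_sinc_le_one s) ?_
    rw [abs_exp, exp_le_one_iff]
    linarith [sq_nonneg s]
  have hM2 : M ^ 2 ≤ (1 + t ^ 2 / n)⁻¹ := by
    refine (max_abs_sinc_exp_sq_le s).trans (le_of_eq ?_)
    rw [hs2]
    ring
  have hMn : M ^ (n - 1) ≤ ((1 + t ^ 2 / 12) ^ 3)⁻¹ := by
    have hm : (n : ℝ) ≤ 12 * ((n - 1) / 6 : ℕ) := by
      exact_mod_cast (by omega : n ≤ 12 * ((n - 1) / 6))
    generalize hmm : (n - 1) / 6 = m at hm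
    have hbern : 1 + t ^ 2 / 12 ≤ (1 + t ^ 2 / n) ^ m := by
      have h0 : 0 ≤ t ^ 2 / n := by positivity
      refine le_trans ?_ (one_add_mul_le_pow (by linarith) m)
      have : t ^ 2 / 12 ≤ m * (t ^ 2 / n) := by
        rw [← mul_div_assoc, div_le_div_iff₀ (by norm_num) hn']
        nlinarith [mul_le_mul_of_nonneg_left hm (sq_nonneg t)]
      linarith
    calc M ^ (n - 1) ≤ M ^ (2 * (m * 3)) := pow_le_pow_of_le_one hM0 hM1 (by omega)
      _ = (M ^ 2) ^ (m * 3) := pow_mul ..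
      _ ≤ (1 + t ^ 2 / n)⁻¹ ^ (m * 3) := by gcongr
      _ = (((1 + t ^ 2 / n) ^ m) ^ 3)⁻¹ := by rw [inv_pow, pow_mul]
      _ ≤ ((1 + t ^ 2 / 12) ^ 3)⁻¹ := by gcongr
  calc |sinc s ^ n - exp (-(t ^ 2 / 2))|
      ≤ |sinc s - exp (-(s ^ 2 / 6))| * n * M ^ (n - 1) := by
        rw [hexp]
        exact abs_pow_sub_pow_le ..
    _ ≤ s ^ 4 * n * ((1 + t ^ 2 / 12) ^ 3)⁻¹ := by
        gcongr
        exact abs_sinc_sub_exp_le s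
    _ = 9 / n * (t ^ 4 * ((1 + t ^ 2 / 12) ^ 3)⁻¹) := by
        rw [show s ^ 4 = (s ^ 2) ^ 2 by ring, hs2]
        field_simp
        norm_num
        ring
    _ ≤ 9 / n * (1728 * (1 + t ^ 2)⁻¹) := by
        refine mul_le_mul_of_nonneg_left ?_ (by positivity)
        rw [← div_eq_mul_inv, ← div_eq_mul_inv, div_le_div_iff₀ (by positivity) (by positivity)]
        nlinarith [sq_nonneg t, pow_nonneg (sq_nonneg t) 2, pow_nonneg (sq_nonneg t) 3]
    _ = 15552 / n * (1 + t ^ 2)⁻¹ := by ring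

theorem abs_integral_sinc_le (R : ℝ) : |∫ t in (0 : ℝ)..R, sinc t| ≤ π + 1 := by
  let K' (u : ℝ) : ℝ :=
    sinc u - sin u * (u / (1 + u ^ 2)) + cos u * ((1 - u ^ 2) / (1 + u ^ 2) ^ 2)
  have hderiv (u : ℝ) : HasDerivAt (fun u ↦ (∫ t in (0 : ℝ)..u, sinc t) + cos u * (u / (1 + u ^ 2)))
      (K' u) u := by
    have hpos : 1 + u ^ 2 ≠ 0 := by positivity
    have h1 := (continuous_sinc.integral_hasStrictDerivAt 0 u).hasDerivAt
    have h2 : HasDerivAt (fun u : ℝ ↦ u / (1 + u ^ 2))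
        ((1 * (1 + u ^ 2) - u * (2 * u)) / (1 + u ^ 2) ^ 2) u :=
      (hasDerivAt_id u).fun_div (by simpa using (hasDerivAt_pow 2 u).const_add 1) hpos
    refine (h1.fun_add ((hasDerivAt_cos u).fun_mul h2)).congr_deriv ?_
    simp only [K']
    field_simp
    ring
  have hK' (u : ℝ) : |K' u| ≤ 2 * (1 + u ^ 2)⁻¹ := by
    have hpos : 0 < 1 + u ^ 2 := by positivity
    have h1 : |sinc u - sin u * (u / (1 + u ^ 2))| ≤ (1 + u ^ 2)⁻¹ := by
      have : sinc u - sin u * (u / (1 + u ^ 2)) = sinc u * (1 + u ^ 2)⁻¹ := by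
        rcases eq_or_ne u 0 with rfl | hu
        · simp
        · rw [sinc_of_ne_zero hu]
          field_simp
          ring
      rw [this, abs_mul, abs_of_pos (inv_pos.2 hpos)]
      exact mul_le_of_le_one_left (inv_pos.2 hpos).le (abs_sinc_le_one u)
    have h2 : |cos u * ((1 - u ^ 2) / (1 + u ^ 2) ^ 2)| ≤ (1 + u ^ 2)⁻¹ := by
      rw [abs_mul]
      refine (mul_le_of_le_one_left (abs_nonneg _) (abs_cos_le_one u)).trans ?_
      rw [abs_div, abs_of_pos (by positivity : 0 < (1 + u ^ 2) ^ 2), div_le_iff₀ (by positivity),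
        pow_two (1 + u ^ 2), inv_mul_cancel_left₀ hpos.ne', abs_le]
      constructor <;> nlinarith [sq_nonneg u]
    exact (abs_add_le _ _).trans (by linarith)
  have hcont : Continuous K' := by
    have := continuous_sinc
    have hpos (u : ℝ) : 1 + u ^ 2 ≠ 0 := by positivity
    have hpos' (u : ℝ) : (1 + u ^ 2) ^ 2 ≠ 0 := by positivity
    fun_prop (disch := assumption)
  have hftc := intervalIntegral.integral_eq_sub_of_hasDerivAt (fun u _ ↦ hderiv u)
    (hcont.intervalIntegrable 0 R)
  simp only [intervalIntegral.integral_same, zero_div, mul_zero, add_zero, sub_zero] at hftc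
  have hbound : |∫ u in (0 : ℝ)..R, K' u| ≤ π := by
    have hdom : IntervalIntegrable (fun u : ℝ ↦ 2 * (1 + u ^ 2)⁻¹) volume 0 R :=
      (integrable_inv_one_add_sq.const_mul 2).intervalIntegrable
    have hnorm (u : ℝ) : ‖K' u‖ ≤ 2 * (1 + u ^ 2)⁻¹ := hK' u
    rw [← norm_eq_abs]
    refine (intervalIntegral.norm_integral_le_abs_of_norm_le (.of_forall hnorm) hdom).trans ?_
    rw [intervalIntegral.integral_const_mul, integral_inv_one_add_sq, arctan_zero, sub_zero,
      abs_le]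
    constructor <;> linarith [arctan_lt_pi_div_two R, neg_pi_div_two_lt_arctan R]
  have hsmall : |cos R * (R / (1 + R ^ 2))| ≤ 1 := by
    rw [abs_mul]
    refine mul_le_one₀ (abs_cos_le_one R) (abs_nonneg _) ?_
    rw [abs_div, abs_of_pos (by positivity : 0 < 1 + R ^ 2), div_le_one (by positivity), abs_le]
    constructor <;> nlinarith [sq_nonneg (R - 1), sq_nonneg (R + 1)]
  rw [abs_le] at *
  constructor <;> linarith

theorem abs_integral_neg_sinc_comp_mul_le (c R : ℝ) :
    |c * ∫ t in (-R)..R, sinc (c * t)| ≤ 2 * (π + 1) := by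
  rw [intervalIntegral.mul_integral_comp_mul_left,
    ← intervalIntegral.integral_interval_sub_left (a := 0)
      (continuous_sinc.intervalIntegrable _ _) (continuous_sinc.intervalIntegrable _ _)]
  refine (abs_sub _ _).trans ?_
  linarith [abs_integral_sinc_le (c * R), abs_integral_sinc_le (c * -R)]

theorem cos_mul_sinc_eq {a : ℝ} (ha : a ≠ 0) (x t : ℝ) :
    cos (t * x) * sinc (a * t) =
      (1 / (2 * a)) * ((a + x) * sinc ((a + x) * t) + (a - x) * sinc ((a - x) * t)) := by
  have key (c t : ℝ) (ht : t ≠ 0) : c * sinc (c * t) = sin (c * t) / t := by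
    rcases eq_or_ne c 0 with rfl | hc
    · simp
    · rw [sinc_of_ne_zero (mul_ne_zero hc ht)]
      field_simp
  rcases eq_or_ne t 0 with rfl | ht
  · simp
    field_simp
    ring
  · rw [key _ _ ht, key _ _ ht, sinc_of_ne_zero (mul_ne_zero ha ht), add_mul, sub_mul, sin_add,
      sin_sub, mul_comm x t]
    field_simp
    ring

/-- The integral of `cos (t * x) * sinc (a * t)` exists only conditionally; the bound holds also for
the value `0` assigned to a Bochner integral that does not exist. -/
theorem abs_integral_cos_mul_sinc_le {a : ℝ} (ha : 0 < a) (x : ℝ) :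
    |∫ t : ℝ, cos (t * x) * sinc (a * t)| ≤ (1 / (2 * a)) * (4 * (π + 1)) := by
  by_cases hint : Integrable fun t : ℝ ↦ cos (t * x) * sinc (a * t)
  · have hlim := intervalIntegral_tendsto_integral hint Filter.tendsto_neg_atTop_atBot
      Filter.tendsto_id
    refine le_of_tendsto hlim.abs (.of_forall fun R ↦ ?_)
    have hc (c : ℝ) : IntervalIntegrable (fun t ↦ c * sinc (c * t)) volume (-R) R :=
      Continuous.intervalIntegrable (by have := continuous_sinc; fun_prop) _ _
    simp only [cos_mul_sinc_eq ha.ne', id]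
    rw [intervalIntegral.integral_const_mul, intervalIntegral.integral_add (hc _) (hc _),
      intervalIntegral.integral_const_mul, intervalIntegral.integral_const_mul, abs_mul,
      abs_of_pos (by positivity : 0 < 1 / (2 * a))]
    gcongr
    refine (abs_add_le _ _).trans ?_
    linarith [abs_integral_neg_sinc_comp_mul_le (a + x) R,
      abs_integral_neg_sinc_comp_mul_le (a - x) R]
  · rw [integral_undef hint, abs_zero]
    positivity

theorem abs_integral_cos_mul_le {g : ℝ → ℝ} {K : ℝ} (hg : ∀ t, |g t| ≤ K * (1 + t ^ 2)⁻¹)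
    (x : ℝ) : |∫ t : ℝ, cos (t * x) * g t| ≤ K * π := by
  rw [← integral_univ_inv_one_add_sq, ← integral_const_mul, ← norm_eq_abs]
  refine norm_integral_le_of_norm_le (integrable_inv_one_add_sq.const_mul K)
    (.of_forall fun t ↦ ?_)
  rw [norm_eq_abs, abs_mul]
  exact (mul_le_of_le_one_left (abs_nonneg _) (abs_cos_le_one _)).trans (hg t)

theorem abs_irwinHallStdDensity_le (n : ℕ) (hn : 1 ≤ n) (x : ℝ) :
    |irwinHallStdDensity n x| ≤ n + 5 := by
  have hn' : (1 : ℝ) ≤ n := by exact_mod_cast hn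
  have hπ := pi_gt_three
  have key : |∫ t : ℝ, cos (t * x) * sinc (√3 * t / √n) ^ n| ≤ (n + 4) * π := by
    rcases hn.eq_or_lt with rfl | hn2
    · have h3 : 1 ≤ √3 := one_le_sqrt.2 (by norm_num)
      have h := abs_integral_cos_mul_sinc_le (a := √3) (by positivity) x
      simp only [Nat.cast_one, sqrt_one, div_one, pow_one]
      refine h.trans ?_
      rw [div_mul_eq_mul_div, div_le_iff₀ (by positivity)]
      nlinarith
    · refine (abs_integral_cos_mul_le (abs_sinc_pow_le n hn2) x).trans ?_
      nlinarith
  rw [irwinHallStdDensity_eq_sinc n hn, abs_mul, abs_of_pos (by positivity), div_mul_eq_mul_div,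
    div_le_iff₀ (by positivity)]
  nlinarith

theorem abs_irwinHallStdDensity_sub_le_of_seven_le (n : ℕ) (hn : 7 ≤ n) (x : ℝ) :
    |irwinHallStdDensity n x - (1 / √(2 * π)) * exp (-x ^ 2 / 2)| ≤ 7776 / n := by
  have hcos : AEStronglyMeasurable (fun t : ℝ ↦ cos (t * x)) :=
    (by fun_prop : Continuous fun t : ℝ ↦ cos (t * x)).aestronglyMeasurable
  have hbdd : ∀ᵐ t : ℝ, ‖cos (t * x)‖ ≤ 1 := .of_forall fun t ↦ abs_cos_le_one _
  have h1 : Integrable fun t : ℝ ↦ sinc (√3 * t / √n) ^ n := by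
    refine (integrable_inv_one_add_sq.const_mul (n : ℝ)).mono' ?_
      (.of_forall fun t ↦ abs_sinc_pow_le n (by omega) t)
    have := continuous_sinc
    exact (by fun_prop : Continuous fun t : ℝ ↦ sinc (√3 * t / √n) ^ n).aestronglyMeasurable
  have h2 : Integrable fun t : ℝ ↦ exp (-(t ^ 2 / 2)) := by
    refine (integrable_exp_neg_mul_sq (b := 1 / 2) (by norm_num)).congr (.of_forall fun t ↦ ?_)
    simp only
    congr 1
    ring
  rw [irwinHallStdDensity_eq_sinc n (by omega), ← integral_cos_mul_exp_neg_sq_div_two, ← mul_sub,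
    ← integral_sub (h1.bdd_mul hcos hbdd) (h2.bdd_mul hcos hbdd)]
  simp only [← mul_sub]
  rw [abs_mul, abs_of_pos (by positivity : 0 < 1 / (2 * π))]
  calc _ ≤ 1 / (2 * π) * (15552 / n * π) := by
        gcongr
        exact abs_integral_cos_mul_le (abs_sinc_pow_sub_exp_le n hn) x
    _ = 7776 / n := by
        field_simp
        norm_num

theorem irwinHall_density_sup_dist_le :
    ∃ C : ℝ, ∀ n : ℕ, 1 ≤ n → ∀ x : ℝ,
      |irwinHallStdDensity n x - (1 / Real.sqrt (2 * π)) * Real.exp (-x ^ 2 / 2)| ≤ C / n := by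
  refine ⟨7776, fun n hn x ↦ ?_⟩
  rcases le_or_gt 7 n with h7 | h7
  · exact abs_irwinHallStdDensity_sub_le_of_seven_le n h7 x
  · have hn' : (0 : ℝ) < n := by exact_mod_cast hn
    have hn7 : (n : ℝ) ≤ 7 := by exact_mod_cast h7.le
    have hφ : |1 / √(2 * π) * exp (-x ^ 2 / 2)| ≤ 1 := by
      rw [abs_of_pos (by positivity)]
      refine mul_le_one₀ ?_ (exp_pos _).le (exp_le_one_iff.2 (by nlinarith [sq_nonneg x]))
      rw [div_le_one (by positivity)]
      exact one_le_sqrt.2 (by linarith [pi_gt_three])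
    rw [le_div_iff₀ hn']
    have := (abs_sub (irwinHallStdDensity n x) (1 / √(2 * π) * exp (-x ^ 2 / 2))).trans
      (add_le_add (abs_irwinHallStdDensity_le n hn x) hφ)
    nlinarith
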